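/- arXiv:1710.05352 — 2 statements merged into one kernel-verified Lean document; each statement's English description precedes it below -/
import Mathlib

section
/- Almost sure convergence criterion for the random series: assume additionally that f is not m-a.e. equal to an indicator function. Then for every complex sequence (a_n)_{n∈ℤ}, the symmetric partial sums ∑_{|n| ≤ N} a_n (ξ_n − σ) converge ℙ-almost surely as N → ∞ if and only if ∑_{n∈ℤ} |a_n|² < ∞. -/
open MeasureTheory Complex Filter Finset
open scoped ENNReal

noncomputable def fhat (f : AddCircle (1:ℝ) → ℝ) (k : ℤ) : ℂ :=
  fourierCoeff (fun t => (f t : ℂ)) k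

section aux_matrix
open scoped ComplexOrder

/-- Expansion of `det (1 + D M)` in principal minors. -/
lemma aux_det_expand {n : Type*} [Fintype n] [DecidableEq n] (b : n → ℂ) (M : Matrix n n ℂ) :
    (1 + Matrix.diagonal b * M).det =
      ∑ s : Finset n, (∏ i ∈ s, b i) *
        (M.submatrix (Subtype.val : s → n) (Subtype.val : s → n)).det := by
  let D := (Matrix.detRowAlternating : (n → ℂ) [⋀^n]→ₗ[ℂ] ℂ)
  rw [add_comm]
  change D ((fun i => (Matrix.diagonal b * M) i) + (fun i => (1 : Matrix n n ℂ) i)) = _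
  rw [D.map_add_univ]
  refine Finset.sum_congr rfl fun s _ => ?_
  have h_smul : s.piecewise (fun i ↦ (Matrix.diagonal b * M) i)
      (fun i ↦ (1 : Matrix n n ℂ) i) =
      fun i => (if i ∈ s then b i else 1) •
        s.piecewise (fun i ↦ M i) (fun i ↦ (1 : Matrix n n ℂ) i) i := by
    funext i j
    simp only [Finset.piecewise, Pi.smul_apply, smul_eq_mul]
    split_ifs
    · simp [Matrix.diagonal_mul]
    · simp
  rw [h_smul, D.map_smul_univ, ← Matrix.det_piecewise_one_eq_submatrix_det]
  simp only [Finset.prod_ite_mem, Finset.univ_inter, smul_eq_mul]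
  rfl

lemma aux_det_le_exp {n : Type*} [Fintype n] [DecidableEq n] (A : Matrix n n ℂ)
    (hA : A.PosSemidef) : A.det.re ≤ Real.exp ((A.trace - Fintype.card n).re) := by
  rw [hA.1.det_eq_prod_eigenvalues, hA.1.trace_eq_sum_eigenvalues]
  have h1 : (∏ i, (hA.1.eigenvalues i : ℂ)) = ((∏ i, hA.1.eigenvalues i : ℝ) : ℂ) := by
    push_cast; rfl
  have h2 : (∑ i, (hA.1.eigenvalues i : ℂ)) - Fintype.card n
      = ((∑ i, (hA.1.eigenvalues i - 1) : ℝ) : ℂ) := by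
    push_cast; simp
  erw [h1, h2]
  rw [Complex.ofReal_re, Complex.ofReal_re, Real.exp_sum]
  refine Finset.prod_le_prod (fun i _ => hA.eigenvalues_nonneg i) fun i _ => ?_
  have := Real.add_one_le_exp (hA.1.eigenvalues i - 1)
  linarith

lemma aux_det_one_add_pos {n : Type*} [Fintype n] [DecidableEq n] (K : Matrix n n ℂ)
    (hK : K.PosSemidef) (hK1 : (1 - K).PosSemidef) (b : n → ℝ)
    (hb : (∀ i, 0 ≤ b i) ∨ (∀ i, -1 ≤ b i ∧ b i ≤ 0)) :
    (1 + Matrix.diagonal (fun i => (b i : ℂ)) * K).det.re ≤ Real.exp (∑ i, b i * (K i i).re) := by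
  have key : ∀ (ε : ℂ) (r : n → ℝ), (∀ i, (b i : ℂ) = ε * (r i * r i)) →
      (1 + ε • ((Matrix.diagonal (fun i => (r i : ℂ))) * K *
        (Matrix.diagonal (fun i => (r i : ℂ))))).PosSemidef →
      (1 + Matrix.diagonal (fun i => (b i : ℂ)) * K).det.re
        ≤ Real.exp (∑ i, b i * (K i i).re) := by
    intro ε r hr hpos
    have e1 : Matrix.diagonal (fun i => (b i : ℂ)) =
        Matrix.diagonal (fun i => (r i : ℂ)) * (ε • Matrix.diagonal (fun i => (r i : ℂ))) := by
      rw [← Matrix.diagonal_smul, Matrix.diagonal_mul_diagonal]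
      congr 1; funext i; rw [hr i]; simp; ring
    have e2 : (1 + Matrix.diagonal (fun i => (b i : ℂ)) * K).det =
        (1 + ε • ((Matrix.diagonal (fun i => (r i : ℂ))) * K *
        (Matrix.diagonal (fun i => (r i : ℂ))))).det := by
      rw [e1, Matrix.mul_assoc, Matrix.det_one_add_mul_comm]
      simp
    rw [e2]
    refine (aux_det_le_exp _ hpos).trans (le_of_eq ?_)
    congr 1
    rw [Matrix.trace_add, Matrix.trace_one, add_sub_cancel_left]
    simp only [Matrix.trace, Matrix.diag, Matrix.smul_apply, Matrix.mul_diagonal,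
      Matrix.diagonal_mul, smul_eq_mul, Complex.re_sum]
    refine Finset.sum_congr rfl fun i _ => ?_
    rw [← Complex.re_ofReal_mul, hr i]
    congr 1; ring
  rcases hb with hb | hb
  · refine key 1 (fun i => √(b i)) (fun i => ?_) ?_
    · rw [← Complex.ofReal_mul, Real.mul_self_sqrt (hb i)]; simp
    · rw [one_smul]
      refine Matrix.PosSemidef.one.add ?_
      have := hK.mul_mul_conjTranspose_same (Matrix.diagonal (fun i => ((√(b i) : ℝ) : ℂ)))
      rw [Matrix.diagonal_conjTranspose] at this
      have h3 : (star fun i => ((√(b i) : ℝ) : ℂ)) = fun i => ((√(b i) : ℝ) : ℂ) := by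
        funext i; simp
      rwa [h3] at this
  · refine key (-1) (fun i => √(-b i)) (fun i => ?_) ?_
    · rw [← Complex.ofReal_mul, Real.mul_self_sqrt (by linarith [(hb i).2])]; simp
    · have h1 := hK1.mul_mul_conjTranspose_same (Matrix.diagonal (fun i => ((√(-b i) : ℝ) : ℂ)))
      rw [Matrix.diagonal_conjTranspose] at h1
      have h2 : (Matrix.diagonal (fun i => ((1 + b i : ℝ) : ℂ))).PosSemidef := by
        apply Matrix.PosSemidef.diagonal
        intro i
        have : (0:ℝ) ≤ 1 + b i := by linarith [(hb i).1]
        exact Complex.zero_le_real.mpr this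
      convert h2.add h1 using 1
      have h3 : (star fun i => ((√(-b i) : ℝ) : ℂ)) = fun i => ((√(-b i) : ℝ) : ℂ) := by
        funext i; simp
      rw [h3, mul_sub, sub_mul, mul_one, Matrix.diagonal_mul_diagonal]
      have h4 : (1 : Matrix n n ℂ) = Matrix.diagonal (fun i => ((1 + b i : ℝ) : ℂ)) +
          Matrix.diagonal (fun i => ((√(-b i) : ℝ) : ℂ) * ((√(-b i) : ℝ) : ℂ)) := by
        rw [Matrix.diagonal_add, ← Matrix.diagonal_one]
        congr 1; funext i
        rw [← Complex.ofReal_mul, Real.mul_self_sqrt (by linarith [(hb i).2])]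
        push_cast; ring
      rw [← add_sub_assoc, ← h4]
      simp [sub_eq_add_neg]

lemma aux_norm_fourier (k : ℤ) (t : AddCircle (1:ℝ)) : ‖(fourier k t : ℂ)‖ = 1 := by
  rw [fourier_apply]; exact Circle.norm_coe _

lemma aux_toeplitz_pos (g : AddCircle (1:ℝ) → ℝ) (hg_meas : Measurable g)
    (hg01 : ∀ t, g t ∈ Set.Icc (0:ℝ) 1) (s : Finset ℤ) :
    (Matrix.of fun i j : s => fhat g ((i:ℤ) - j)).PosSemidef := by
  have hint : ∀ k : ℤ, Integrable (fun t : AddCircle (1:ℝ) => fourier k t * (g t : ℂ))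
      AddCircle.haarAddCircle := by
    intro k
    refine Integrable.of_bound (C := 1) ?_ ?_
    · exact ((fourier k).continuous.measurable.mul
        (Complex.measurable_ofReal.comp hg_meas)).aestronglyMeasurable
    · refine Filter.Eventually.of_forall fun t => ?_
      rw [norm_mul, Complex.norm_real, Real.norm_of_nonneg (hg01 t).1]
      have : ‖(fourier k t : ℂ)‖ = 1 := aux_norm_fourier _ _
      rw [this, one_mul]; exact (hg01 t).2
  have hfh : ∀ k, fhat g k = ∫ t, fourier (-k) t * (g t : ℂ) ∂AddCircle.haarAddCircle := by
    intro k; simp [fhat, fourierCoeff]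
  refine Matrix.PosSemidef.of_dotProduct_mulVec_nonneg ?_ ?_
  · ext i j
    simp only [Matrix.conjTranspose_apply, Matrix.of_apply, hfh]
    rw [Complex.star_def, ← integral_conj]
    congr 1; funext t
    rw [map_mul, Complex.conj_ofReal, ← fourier_neg]
    congr 3; ring
  · intro x
    have : star x ⬝ᵥ ((Matrix.of fun i j : s => fhat g ((i:ℤ) - j)).mulVec x) =
        ((∫ t, g t * ‖∑ i : s, x i * fourier (i:ℤ) t‖^2 ∂AddCircle.haarAddCircle : ℝ) : ℂ) := by
      rw [← integral_complex_ofReal]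
      have h1 : ∀ t, (((g t * ‖∑ i : s, x i * fourier (i:ℤ) t‖^2 : ℝ)) : ℂ) =
          ∑ i : s, ∑ j : s, star (x i) * x j * (fourier (-((i:ℤ) - j)) t * (g t : ℂ)) := by
        intro t
        push_cast
        rw [← Complex.conj_mul', map_sum, Finset.sum_mul_sum, Finset.mul_sum]
        refine Finset.sum_congr rfl fun i _ => ?_
        rw [Finset.mul_sum]
        refine Finset.sum_congr rfl fun j _ => ?_
        rw [show -((i:ℤ) - j) = -(i:ℤ) + j by ring, fourier_add, map_mul, ← fourier_neg,
          Complex.star_def]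
        ring
      simp_rw [h1]
      rw [integral_finsetSum _ (fun i _ => integrable_finsetSum _ fun j _ =>
        (hint _).const_mul _)]
      rw [dotProduct]
      refine Finset.sum_congr rfl fun i _ => ?_
      rw [integral_finsetSum _ (fun j _ => (hint _).const_mul _), Matrix.mulVec, dotProduct,
        Finset.mul_sum]
      refine Finset.sum_congr rfl fun j _ => ?_
      rw [integral_const_mul, Matrix.of_apply, hfh, Pi.star_apply]
      ring
    rw [this]
    have h0 : (0:ℝ) ≤ ∫ t, g t * ‖∑ i : s, x i * fourier (i:ℤ) t‖^2 ∂AddCircle.haarAddCircle :=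
      integral_nonneg fun t => mul_nonneg (hg01 t).1 (sq_nonneg _)
    exact_mod_cast h0

lemma aux_fhat_one_sub (f : AddCircle (1:ℝ) → ℝ) (hf_meas : Measurable f)
    (hf01 : ∀ t, f t ∈ Set.Icc (0:ℝ) 1) (k : ℤ) :
    fhat (fun t => 1 - f t) k = (if k = 0 then 1 else 0) - fhat f k := by
  have hint : Integrable (fun t : AddCircle (1:ℝ) => fourier (-k) t * (f t : ℂ))
      AddCircle.haarAddCircle := by
    refine Integrable.of_bound (C := 1) ?_ ?_
    · exact ((fourier (-k)).continuous.measurable.mul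
        (Complex.measurable_ofReal.comp hf_meas)).aestronglyMeasurable
    · refine Filter.Eventually.of_forall fun t => ?_
      rw [norm_mul, Complex.norm_real, Real.norm_of_nonneg (hf01 t).1]
      have : ‖(fourier (-k) t : ℂ)‖ = 1 := aux_norm_fourier _ _
      rw [this, one_mul]; exact (hf01 t).2
  have hint1 : Integrable (fun t : AddCircle (1:ℝ) => fourier (-k) t)
      AddCircle.haarAddCircle := by
    refine Integrable.of_bound (C := 1) (fourier (-k)).continuous.aestronglyMeasurable ?_
    refine Filter.Eventually.of_forall fun t => ?_
    exact (aux_norm_fourier _ _).le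
  have h1 : ∫ t : AddCircle (1:ℝ), (fourier (-k) t : ℂ) ∂AddCircle.haarAddCircle
      = if k = 0 then 1 else 0 := by
    have := (orthonormal_iff_ite.mp (orthonormal_fourier (T := (1:ℝ)))) k 0
    rw [ContinuousMap.inner_toLp] at this
    simpa [← fourier_neg] using this
  simp only [fhat, fourierCoeff, smul_eq_mul]
  rw [← h1, ← integral_sub hint1 hint]
  congr 1; funext t; push_cast; ring

lemma aux_fhat_zero (f : AddCircle (1:ℝ) → ℝ) :
    fhat f 0 = ((∫ t, f t ∂AddCircle.haarAddCircle : ℝ) : ℂ) := by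
  simp [fhat, fourierCoeff, integral_complex_ofReal]

end aux_matrix

lemma aux_integrable {Ω : Type*} [MeasurableSpace Ω] (P : Measure Ω) [IsProbabilityMeasure P]
    {X : Ω → ℝ} (hX : Measurable X) (hb : ∃ C, ∀ ω, |X ω| ≤ C) : Integrable X P := by
  obtain ⟨C, hC⟩ := hb
  exact Integrable.of_bound (C := C) hX.aestronglyMeasurable (Eventually.of_forall hC)

lemma aux_minor {f : AddCircle (1:ℝ) → ℝ}
    {Ω : Type*} [MeasurableSpace Ω] (P : Measure Ω)
    (ξ : ℤ → Ω → ℝ)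
    (hDPP : ∀ (k : ℕ) (n : Fin k → ℤ), Function.Injective n →
      ((∫ ω, ∏ i, ξ (n i) ω ∂P : ℝ) : ℂ) =
        Matrix.det (Matrix.of fun i j => fhat f (n i - n j)))
    (s : Finset ℤ) (t : Finset s) :
    ((∫ ω, ∏ i ∈ t, ξ i ω ∂P : ℝ) : ℂ) =
      ((Matrix.of fun i j : s => fhat f ((i:ℤ) - j)).submatrix
        (Subtype.val : t → s) (Subtype.val : t → s)).det := by
  let e := t.equivFin.symm
  have h := hDPP t.card (fun i => (((e i : t) : s) : ℤ))
    (Subtype.val_injective.comp (Subtype.val_injective.comp e.injective))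
  rw [← Matrix.det_submatrix_equiv_self e]
  convert h using 4 with ω
  · rw [← Finset.prod_coe_sort]
    exact (Equiv.prod_comp e (fun i : t => ξ ((i : s) : ℤ) ω)).symm
  · rfl

section aux_moments
open scoped ComplexOrder

lemma aux_mgf (f : AddCircle (1:ℝ) → ℝ) (hf_meas : Measurable f)
    (hf01 : ∀ t, f t ∈ Set.Icc (0:ℝ) 1)
    (σ : ℝ) (hσ : σ = ∫ t, f t ∂AddCircle.haarAddCircle)
    {Ω : Type*} [MeasurableSpace Ω] (P : Measure Ω) [IsProbabilityMeasure P]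
    (ξ : ℤ → Ω → ℝ) (hξ_meas : ∀ n, Measurable (ξ n))
    (hξ01 : ∀ n ω, ξ n ω = 0 ∨ ξ n ω = 1)
    (hDPP : ∀ (k : ℕ) (n : Fin k → ℤ), Function.Injective n →
      ((∫ ω, ∏ i, ξ (n i) ω ∂P : ℝ) : ℂ) =
        Matrix.det (Matrix.of fun i j => fhat f (n i - n j)))
    (s : Finset ℤ) (b : ℤ → ℝ)
    (hb : (∀ i ∈ s, 0 ≤ b i) ∨ (∀ i ∈ s, -1 ≤ b i ∧ b i ≤ 0)) :
    ∫ ω, ∏ i ∈ s, (1 + b i * ξ i ω) ∂P ≤ Real.exp (σ * ∑ i ∈ s, b i) := by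
  set K : Matrix s s ℂ := Matrix.of fun i j : s => fhat f ((i:ℤ) - j) with hK
  have hK0 : K.PosSemidef := aux_toeplitz_pos f hf_meas hf01 s
  have hK1 : (1 - K).PosSemidef := by
    have := aux_toeplitz_pos (fun t => 1 - f t) (measurable_const.sub hf_meas)
      (fun t => ⟨by linarith [(hf01 t).2], by linarith [(hf01 t).1]⟩) s
    convert this using 1
    ext i j
    simp only [Matrix.of_apply, aux_fhat_one_sub f hf_meas hf01, Matrix.sub_apply, hK,
      Matrix.one_apply, sub_eq_zero, Subtype.ext_iff]
  have hdet := aux_det_one_add_pos K hK0 hK1 (fun i : s => b i)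
    (hb.imp (fun h i => h i i.2) (fun h i => h i i.2))
  have hexp : Real.exp (∑ i : s, b i * (K i i).re) = Real.exp (σ * ∑ i ∈ s, b i) := by
    congr 1
    rw [Finset.mul_sum, ← Finset.sum_coe_sort s]
    refine Finset.sum_congr rfl fun i _ => ?_
    simp only [hK, Matrix.of_apply, sub_self, aux_fhat_zero, Complex.ofReal_re, hσ]
    ring
  rw [hexp] at hdet
  refine le_trans (le_of_eq ?_) hdet
  rw [aux_det_expand]
  have hint : ∀ t : Finset s, Integrable (fun ω => ∏ i ∈ t, ξ i ω) P := by
    intro t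
    refine aux_integrable P (Finset.measurable_prod _ fun i _ => hξ_meas _) ⟨1, fun ω => ?_⟩
    rw [Finset.abs_prod]
    refine Finset.prod_le_one (fun _ _ => abs_nonneg _) fun i _ => ?_
    rcases hξ01 i ω with h | h <;> simp [h]
  have h1 : ∀ ω, ∏ i ∈ s, (1 + b i * ξ i ω) =
      ∑ t : Finset s, (∏ i ∈ t, b i) * ∏ i ∈ t, ξ i ω := by
    intro ω
    rw [← Finset.prod_coe_sort, Finset.prod_one_add, Finset.powerset_univ]
    simp only [Finset.prod_mul_distrib]
  simp_rw [h1]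
  rw [integral_finsetSum _ (fun t _ => (hint t).const_mul _), Complex.re_sum]
  refine Finset.sum_congr rfl fun t _ => ?_
  rw [integral_const_mul, ← aux_minor P ξ hDPP s t, ← Complex.ofReal_prod,
    ← Complex.ofReal_mul, Complex.ofReal_re]

end aux_moments

lemma aux_S_meas {Ω : Type*} [MeasurableSpace Ω]
    (ξ : ℤ → Ω → ℝ) (hξ_meas : ∀ n, Measurable (ξ n)) (σ : ℝ) (s : Finset ℤ) (a : ℤ → ℝ) :
    Measurable (fun ω => ∑ i ∈ s, a i * (ξ i ω - σ)) :=
  Finset.measurable_sum _ fun i _ => ((hξ_meas i).sub_const σ).const_mul _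

lemma aux_S_bdd {Ω : Type*} (ξ : ℤ → Ω → ℝ) (hξ01 : ∀ n ω, ξ n ω = 0 ∨ ξ n ω = 1)
    (σ : ℝ) (s : Finset ℤ) (a : ℤ → ℝ) :
    ∃ C, ∀ ω, |∑ i ∈ s, a i * (ξ i ω - σ)| ≤ C := by
  refine ⟨∑ i ∈ s, |a i| * (1 + |σ|), fun ω => (Finset.abs_sum_le_sum_abs _ _).trans ?_⟩
  refine Finset.sum_le_sum fun i _ => ?_
  rw [abs_mul]
  refine mul_le_mul_of_nonneg_left ((abs_sub _ _).trans ?_) (abs_nonneg _)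
  rcases hξ01 i ω with h | h <;> simp [h]

lemma aux_S_int_pow {Ω : Type*} [MeasurableSpace Ω] (P : Measure Ω) [IsProbabilityMeasure P]
    (ξ : ℤ → Ω → ℝ) (hξ_meas : ∀ n, Measurable (ξ n))
    (hξ01 : ∀ n ω, ξ n ω = 0 ∨ ξ n ω = 1) (σ : ℝ) (s : Finset ℤ) (a : ℤ → ℝ) (k : ℕ) :
    Integrable (fun ω => (∑ i ∈ s, a i * (ξ i ω - σ))^k) P := by
  obtain ⟨C, hC⟩ := aux_S_bdd ξ hξ01 σ s a
  refine aux_integrable P ((aux_S_meas ξ hξ_meas σ s a).pow_const k) ⟨C^k, fun ω => ?_⟩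
  rw [abs_pow]
  exact pow_le_pow_left₀ (abs_nonneg _) (hC ω) k

lemma aux_exp_moment (f : AddCircle (1:ℝ) → ℝ) (hf_meas : Measurable f)
    (hf01 : ∀ t, f t ∈ Set.Icc (0:ℝ) 1)
    (σ : ℝ) (hσ : σ = ∫ t, f t ∂AddCircle.haarAddCircle) (hσ0 : 0 < σ) (hσ1 : σ < 1)
    {Ω : Type*} [MeasurableSpace Ω] (P : Measure Ω) [IsProbabilityMeasure P]
    (ξ : ℤ → Ω → ℝ) (hξ_meas : ∀ n, Measurable (ξ n))
    (hξ01 : ∀ n ω, ξ n ω = 0 ∨ ξ n ω = 1)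
    (hDPP : ∀ (k : ℕ) (n : Fin k → ℤ), Function.Injective n →
      ((∫ ω, ∏ i, ξ (n i) ω ∂P : ℝ) : ℂ) =
        Matrix.det (Matrix.of fun i j => fhat f (n i - n j)))
    (s : Finset ℤ) (a : ℤ → ℝ)
    (ha : (∀ i ∈ s, 0 ≤ a i) ∨ (∀ i ∈ s, a i ≤ 0)) (hV : ∑ i ∈ s, (a i)^2 ≤ 1) :
    ∫ ω, Real.exp (∑ i ∈ s, a i * (ξ i ω - σ)) ∂P ≤ 3 := by
  have h1 : ∀ ω, Real.exp (∑ i ∈ s, a i * (ξ i ω - σ)) =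
      Real.exp (-(σ * ∑ i ∈ s, a i)) * ∏ i ∈ s, (1 + (Real.exp (a i) - 1) * ξ i ω) := by
    intro ω
    have h2 : ∑ i ∈ s, a i * (ξ i ω - σ) = -(σ * ∑ i ∈ s, a i) + ∑ i ∈ s, a i * ξ i ω := by
      rw [Finset.mul_sum, ← Finset.sum_neg_distrib, ← Finset.sum_add_distrib]
      exact Finset.sum_congr rfl fun i _ => by ring
    rw [h2, Real.exp_add, Real.exp_sum]
    congr 1
    refine Finset.prod_congr rfl fun i _ => ?_
    rcases hξ01 i ω with h | h <;> simp [h]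
  simp_rw [h1]
  rw [integral_const_mul]
  have h2 := aux_mgf f hf_meas hf01 σ hσ P ξ hξ_meas hξ01 hDPP s (fun i => Real.exp (a i) - 1)
    (by
      refine ha.imp (fun h i hi => ?_) (fun h i hi => ⟨?_, ?_⟩)
      · have := Real.one_le_exp (h i hi); linarith
      · have := Real.exp_pos (a i); linarith
      · have := Real.exp_le_one_iff.mpr (h i hi); linarith)
  have h3 : ∑ i ∈ s, (Real.exp (a i) - 1) - ∑ i ∈ s, a i ≤ 1 := by
    rw [← Finset.sum_sub_distrib]
    refine le_trans (Finset.sum_le_sum fun i hi => ?_) hV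
    have h4 : (a i)^2 ≤ 1 :=
      le_trans (Finset.single_le_sum (f := fun i => (a i)^2) (fun _ _ => sq_nonneg _) hi) hV
    have h5 : |a i| ≤ 1 := by
      rw [← sq_abs] at h4
      nlinarith [abs_nonneg (a i)]
    exact (le_abs_self _).trans (Real.abs_exp_sub_one_sub_id_le h5)
  calc Real.exp (-(σ * ∑ i ∈ s, a i)) * ∫ ω, ∏ i ∈ s, (1 + (Real.exp (a i) - 1) * ξ i ω) ∂P
      ≤ Real.exp (-(σ * ∑ i ∈ s, a i)) * Real.exp (σ * ∑ i ∈ s, (Real.exp (a i) - 1)) :=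
        mul_le_mul_of_nonneg_left h2 (Real.exp_pos _).le
    _ = Real.exp (σ * (∑ i ∈ s, (Real.exp (a i) - 1) - ∑ i ∈ s, a i)) := by
        rw [← Real.exp_add]; congr 1; ring
    _ ≤ Real.exp 1 := by
        apply Real.exp_le_exp.mpr
        nlinarith
    _ ≤ 3 := Real.exp_one_lt_three.le

lemma aux_fourth_pos (f : AddCircle (1:ℝ) → ℝ) (hf_meas : Measurable f)
    (hf01 : ∀ t, f t ∈ Set.Icc (0:ℝ) 1)
    (σ : ℝ) (hσ : σ = ∫ t, f t ∂AddCircle.haarAddCircle) (hσ0 : 0 < σ) (hσ1 : σ < 1)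
    {Ω : Type*} [MeasurableSpace Ω] (P : Measure Ω) [IsProbabilityMeasure P]
    (ξ : ℤ → Ω → ℝ) (hξ_meas : ∀ n, Measurable (ξ n))
    (hξ01 : ∀ n ω, ξ n ω = 0 ∨ ξ n ω = 1)
    (hDPP : ∀ (k : ℕ) (n : Fin k → ℤ), Function.Injective n →
      ((∫ ω, ∏ i, ξ (n i) ω ∂P : ℝ) : ℂ) =
        Matrix.det (Matrix.of fun i j => fhat f (n i - n j)))
    (s : Finset ℤ) (a : ℤ → ℝ) (ha : ∀ i ∈ s, 0 ≤ a i) :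
    ∫ ω, (∑ i ∈ s, a i * (ξ i ω - σ))^4 ∂P ≤ 144 * (∑ i ∈ s, (a i)^2)^2 := by
  set V := ∑ i ∈ s, (a i)^2 with hVdef
  have hV0 : 0 ≤ V := Finset.sum_nonneg fun _ _ => sq_nonneg _
  rcases hV0.eq_or_lt with hV | hV
  · have h0 : ∀ i ∈ s, a i = 0 := by
      intro i hi
      have := (Finset.sum_eq_zero_iff_of_nonneg (fun i _ => sq_nonneg (a i))).mp hV.symm i hi
      exact pow_eq_zero_iff (two_ne_zero) |>.mp this
    have h1 : ∀ ω, ∑ i ∈ s, a i * (ξ i ω - σ) = 0 := fun ω =>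
      Finset.sum_eq_zero fun i hi => by rw [h0 i hi, zero_mul]
    simp only [h1]
    rw [← hV]; simp
  · set r := √V with hr
    have hr0 : 0 < r := Real.sqrt_pos.mpr hV
    have hr2 : r^2 = V := Real.sq_sqrt hV0
    have hVn : ∀ ε : ℝ, ε^2 = 1 → ∑ i ∈ s, (ε * (a i / r))^2 ≤ 1 := by
      intro ε hε
      have : ∀ i, (ε * (a i / r))^2 = (a i)^2 / V := by
        intro i; rw [mul_pow, hε, one_mul, div_pow, hr2]
      simp_rw [this]
      rw [← Finset.sum_div, ← hVdef, div_self hV.ne']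
    have hp := aux_exp_moment f hf_meas hf01 σ hσ hσ0 hσ1 P ξ hξ_meas hξ01 hDPP s
      (fun i => 1 * (a i / r)) (Or.inl fun i hi => by
        have := ha i hi; positivity) (hVn 1 (by norm_num))
    have hm := aux_exp_moment f hf_meas hf01 σ hσ hσ0 hσ1 P ξ hξ_meas hξ01 hDPP s
      (fun i => (-1) * (a i / r)) (Or.inr fun i hi => by
        have : 0 ≤ a i / r := div_nonneg (ha i hi) hr0.le
        linarith) (hVn (-1) (by norm_num))
    have he : ∀ ε : ℝ, Integrable
        (fun ω => Real.exp (∑ i ∈ s, (ε * (a i / r)) * (ξ i ω - σ))) P := by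
      intro ε
      obtain ⟨C, hC⟩ := aux_S_bdd ξ hξ01 σ s (fun i => ε * (a i / r))
      refine aux_integrable P (Real.measurable_exp.comp
        (aux_S_meas ξ hξ_meas σ s _)) ⟨Real.exp C, fun ω => ?_⟩
      rw [Real.abs_exp]
      exact Real.exp_le_exp.mpr ((le_abs_self _).trans (hC ω))
    have hpt : ∀ ω, (∑ i ∈ s, a i * (ξ i ω - σ))^4 ≤ V^2 * (24 *
        (Real.exp (∑ i ∈ s, (1 * (a i / r)) * (ξ i ω - σ)) +
          Real.exp (∑ i ∈ s, ((-1) * (a i / r)) * (ξ i ω - σ)))) := by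
      intro ω
      set x := ∑ i ∈ s, a i * (ξ i ω - σ) with hx
      have e : ∀ ε : ℝ, ∑ i ∈ s, (ε * (a i / r)) * (ξ i ω - σ) = ε * (x / r) := by
        intro ε
        rw [hx, Finset.sum_div, Finset.mul_sum]
        exact Finset.sum_congr rfl fun i _ => by ring
      rw [e, e]
      have h4 : (x/r)^4 ≤ 24 * Real.exp |x/r| := by
        have := Real.pow_div_factorial_le_exp |x/r| (abs_nonneg _) 4
        rw [show ((Nat.factorial 4 : ℕ) : ℝ) = 24 by norm_num [Nat.factorial],
          Even.pow_abs (by decide)] at this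
        linarith
      have h5 : Real.exp |x/r| ≤ Real.exp (1 * (x/r)) + Real.exp (-1 * (x/r)) := by
        rcases abs_cases (x/r) with ⟨h, _⟩ | ⟨h, _⟩
        · rw [h, one_mul]; linarith [Real.exp_pos (-1 * (x/r))]
        · rw [h, neg_one_mul]; linarith [Real.exp_pos (1 * (x/r))]
      have h6 : x^4 = V^2 * (x/r)^4 := by
        rw [← hr2]; field_simp
      rw [h6]
      refine mul_le_mul_of_nonneg_left ?_ (sq_nonneg V)
      linarith
    refine (integral_mono (aux_S_int_pow P ξ hξ_meas hξ01 σ s a 4)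
      ((((he 1).add (he (-1))).const_mul 24).const_mul (V^2)) hpt).trans ?_
    rw [integral_const_mul, integral_const_mul]
    simp only [Pi.add_apply]
    rw [integral_add (he 1) (he (-1))]
    nlinarith [sq_nonneg V]

lemma aux_fourth (f : AddCircle (1:ℝ) → ℝ) (hf_meas : Measurable f)
    (hf01 : ∀ t, f t ∈ Set.Icc (0:ℝ) 1)
    (σ : ℝ) (hσ : σ = ∫ t, f t ∂AddCircle.haarAddCircle) (hσ0 : 0 < σ) (hσ1 : σ < 1)
    {Ω : Type*} [MeasurableSpace Ω] (P : Measure Ω) [IsProbabilityMeasure P]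
    (ξ : ℤ → Ω → ℝ) (hξ_meas : ∀ n, Measurable (ξ n))
    (hξ01 : ∀ n ω, ξ n ω = 0 ∨ ξ n ω = 1)
    (hDPP : ∀ (k : ℕ) (n : Fin k → ℤ), Function.Injective n →
      ((∫ ω, ∏ i, ξ (n i) ω ∂P : ℝ) : ℂ) =
        Matrix.det (Matrix.of fun i j => fhat f (n i - n j)))
    (s : Finset ℤ) (a : ℤ → ℝ) :
    ∫ ω, (∑ i ∈ s, a i * (ξ i ω - σ))^4 ∂P ≤ 2304 * (∑ i ∈ s, (a i)^2)^2 := by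
  set V := ∑ i ∈ s, (a i)^2 with hVdef
  have hp := aux_fourth_pos f hf_meas hf01 σ hσ hσ0 hσ1 P ξ hξ_meas hξ01 hDPP s
    (fun i => max (a i) 0) (fun i _ => le_max_right _ _)
  have hm := aux_fourth_pos f hf_meas hf01 σ hσ hσ0 hσ1 P ξ hξ_meas hξ01 hDPP s
    (fun i => max (-a i) 0) (fun i _ => le_max_right _ _)
  have hle : ∀ c : ℤ → ℝ, (∀ i, (c i)^2 ≤ (a i)^2) → (∑ i ∈ s, (c i)^2)^2 ≤ V^2 := fun c hc =>
    pow_le_pow_left₀ (Finset.sum_nonneg fun _ _ => sq_nonneg _)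
      (Finset.sum_le_sum fun i _ => hc i) 2
  have hp' := hle (fun i => max (a i) 0) (fun i => by
    rcases max_cases (a i) 0 with ⟨h, _⟩ | ⟨h, _⟩ <;> simp only [h] <;> nlinarith [sq_nonneg (a i)])
  have hm' := hle (fun i => max (-a i) 0) (fun i => by
    rcases max_cases (-a i) 0 with ⟨h, _⟩ | ⟨h, _⟩ <;> simp only [h] <;> nlinarith [sq_nonneg (a i)])
  have i1 := aux_S_int_pow P ξ hξ_meas hξ01 σ s (fun i => max (a i) 0) 4
  have i2 := aux_S_int_pow P ξ hξ_meas hξ01 σ s (fun i => max (-a i) 0) 4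
  have hpt : ∀ ω, (∑ i ∈ s, a i * (ξ i ω - σ))^4 ≤
      8 * ((∑ i ∈ s, max (a i) 0 * (ξ i ω - σ))^4 + (∑ i ∈ s, max (-a i) 0 * (ξ i ω - σ))^4) := by
    intro ω
    have : ∑ i ∈ s, a i * (ξ i ω - σ) = ∑ i ∈ s, max (a i) 0 * (ξ i ω - σ)
        - ∑ i ∈ s, max (-a i) 0 * (ξ i ω - σ) := by
      rw [← Finset.sum_sub_distrib]
      refine Finset.sum_congr rfl fun i _ => ?_
      rw [← sub_mul]
      congr 1
      rcases max_cases (a i) 0 with ⟨h, _⟩ | ⟨h, _⟩ <;>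
        rcases max_cases (-a i) 0 with ⟨h', _⟩ | ⟨h', _⟩ <;> rw [h, h'] <;> linarith
    rw [this]
    generalize (∑ i ∈ s, max (a i) 0 * (ξ i ω - σ)) = x
    generalize (∑ i ∈ s, max (-a i) 0 * (ξ i ω - σ)) = y
    have h1 : (x - y)^2 ≤ 2 * (x^2 + y^2) := by nlinarith [sq_nonneg (x + y)]
    have h2 : ((x - y)^2)^2 ≤ (2 * (x^2 + y^2))^2 := pow_le_pow_left₀ (sq_nonneg _) h1 2
    nlinarith [sq_nonneg (x^2 - y^2)]
  refine (integral_mono (aux_S_int_pow P ξ hξ_meas hξ01 σ s a 4)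
    ((i1.add i2).const_mul 8) hpt).trans ?_
  rw [integral_const_mul]
  simp only [Pi.add_apply]
  rw [integral_add i1 i2]
  linarith

lemma aux_fhat_neg (f : AddCircle (1:ℝ) → ℝ) (k : ℤ) :
    fhat f (-k) = (starRingEnd ℂ) (fhat f k) := by
  simp only [fhat, fourierCoeff, smul_eq_mul]
  rw [← integral_conj]
  congr 1; funext t
  rw [map_mul, Complex.conj_ofReal, ← fourier_neg]

lemma aux_bessel (f : AddCircle (1:ℝ) → ℝ) (hf_meas : Measurable f)
    (hf01 : ∀ t, f t ∈ Set.Icc (0:ℝ) 1) (s : Finset ℤ) (i : ℤ) :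
    ∑ j ∈ s, ‖fhat f (i - j)‖^2 ≤ ∫ t, (f t)^2 ∂AddCircle.haarAddCircle := by
  have hL : MemLp (fun t => (f t : ℂ)) 2 (AddCircle.haarAddCircle (T := (1:ℝ))) := by
    refine MemLp.of_bound (Complex.measurable_ofReal.comp hf_meas).aestronglyMeasurable 1
      (Eventually.of_forall fun t => ?_)
    rw [Complex.norm_real, Real.norm_of_nonneg (hf01 t).1]; exact (hf01 t).2
  obtain ⟨g, hg⟩ : ∃ g : Lp ℂ 2 (AddCircle.haarAddCircle (T := (1:ℝ))),
      (g : AddCircle (1:ℝ) → ℂ) =ᵐ[AddCircle.haarAddCircle] fun t => (f t : ℂ) :=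
    ⟨hL.toLp _, hL.coeFn_toLp⟩
  have h := hasSum_sq_fourierCoeff g
  have hc : ∀ k, fourierCoeff g k = fhat f k := by
    intro k
    simp only [fhat, fourierCoeff]
    refine integral_congr_ae ?_
    filter_upwards [hg] with t ht
    rw [ht]
  have hi : ∫ t, ‖g t‖^2 ∂AddCircle.haarAddCircle
      = ∫ t, (f t)^2 ∂AddCircle.haarAddCircle := by
    refine integral_congr_ae ?_
    filter_upwards [hg] with t ht
    rw [ht, Complex.norm_real, Real.norm_eq_abs, sq_abs]
  simp_rw [hc] at h
  rw [hi] at h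
  have h' := (Equiv.subLeft i).hasSum_iff.mpr h
  have h2 := sum_le_hasSum s (fun j _ => sq_nonneg ‖fhat f (Equiv.subLeft i j)‖) h'
  simpa only [Equiv.subLeft_apply] using h2

lemma aux_cov (f : AddCircle (1:ℝ) → ℝ)
    (σ : ℝ) (hσ : σ = ∫ t, f t ∂AddCircle.haarAddCircle)
    {Ω : Type*} [MeasurableSpace Ω] (P : Measure Ω) [IsProbabilityMeasure P]
    (ξ : ℤ → Ω → ℝ) (hξ_meas : ∀ n, Measurable (ξ n))
    (hξ01 : ∀ n ω, ξ n ω = 0 ∨ ξ n ω = 1)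
    (hDPP : ∀ (k : ℕ) (n : Fin k → ℤ), Function.Injective n →
      ((∫ ω, ∏ i, ξ (n i) ω ∂P : ℝ) : ℂ) =
        Matrix.det (Matrix.of fun i j => fhat f (n i - n j))) (i j : ℤ) :
    Integrable (fun ω => (ξ i ω - σ) * (ξ j ω - σ)) P ∧
    ∫ ω, (ξ i ω - σ) * (ξ j ω - σ) ∂P = (if i = j then σ else 0) - ‖fhat f (i - j)‖^2 := by
  have hI : ∀ i, Integrable (ξ i) P := fun i =>
    aux_integrable P (hξ_meas i) ⟨1, fun ω => by rcases hξ01 i ω with h | h <;> simp [h]⟩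
  have hII : Integrable (fun ω => ξ i ω * ξ j ω) P :=
    aux_integrable P ((hξ_meas i).mul (hξ_meas j)) ⟨1, fun ω => by
      rcases hξ01 i ω with h | h <;> rcases hξ01 j ω with h' | h' <;> simp [h, h']⟩
  have hE : ∀ i, ∫ ω, ξ i ω ∂P = σ := by
    intro i
    have := hDPP 1 (fun _ => i) (Function.injective_of_subsingleton _)
    simp [aux_fhat_zero, ← hσ] at this
    exact_mod_cast this
  have hdec : (fun ω => (ξ i ω - σ) * (ξ j ω - σ)) =
      fun ω => ξ i ω * ξ j ω - σ * ξ i ω - σ * ξ j ω + σ^2 := by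
    funext ω; ring
  have hint : Integrable (fun ω => (ξ i ω - σ) * (ξ j ω - σ)) P := by
    rw [hdec]
    exact ((hII.sub ((hI i).const_mul σ)).sub ((hI j).const_mul σ)).add (integrable_const _)
  refine ⟨hint, ?_⟩
  have hJ1 : Integrable (fun ω => ξ i ω * ξ j ω - σ * ξ i ω) P := hII.sub ((hI i).const_mul σ)
  have hJ2 : Integrable (fun ω => ξ i ω * ξ j ω - σ * ξ i ω - σ * ξ j ω) P :=
    hJ1.sub ((hI j).const_mul σ)
  have hval : ∫ ω, (ξ i ω - σ) * (ξ j ω - σ) ∂P = ∫ ω, ξ i ω * ξ j ω ∂P - σ^2 := by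
    rw [hdec, integral_add hJ2 (integrable_const _), integral_sub hJ1 ((hI j).const_mul σ),
      integral_sub hII ((hI i).const_mul σ), integral_const_mul, integral_const_mul, hE, hE]
    simp
    ring
  rw [hval]
  by_cases hij : i = j
  · subst hij
    have : ∀ ω, ξ i ω * ξ i ω = ξ i ω := fun ω => by
      rcases hξ01 i ω with h | h <;> simp [h]
    simp_rw [this]
    rw [hE, sub_self, aux_fhat_zero, ← hσ, Complex.norm_real, Real.norm_eq_abs, sq_abs]
    simp
  · have h2 := hDPP 2 ![i, j] (by
      intro x y hxy
      fin_cases x <;> fin_cases y <;> simp_all [eq_comm])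
    rw [Matrix.det_fin_two] at h2
    simp only [Fin.prod_univ_two, Matrix.of_apply, Matrix.cons_val_zero, Matrix.cons_val_one,
      sub_self, aux_fhat_zero, ← hσ] at h2
    rw [← neg_sub i j, aux_fhat_neg, Complex.mul_conj'] at h2
    have h3 : ∫ ω, ξ i ω * ξ j ω ∂P = σ * σ - ‖fhat f (i - j)‖^2 := by exact_mod_cast h2
    rw [h3, if_neg hij]; ring

lemma aux_second (f : AddCircle (1:ℝ) → ℝ) (hf_meas : Measurable f)
    (hf01 : ∀ t, f t ∈ Set.Icc (0:ℝ) 1)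
    (σ : ℝ) (hσ : σ = ∫ t, f t ∂AddCircle.haarAddCircle)
    {Ω : Type*} [MeasurableSpace Ω] (P : Measure Ω) [IsProbabilityMeasure P]
    (ξ : ℤ → Ω → ℝ) (hξ_meas : ∀ n, Measurable (ξ n))
    (hξ01 : ∀ n ω, ξ n ω = 0 ∨ ξ n ω = 1)
    (hDPP : ∀ (k : ℕ) (n : Fin k → ℤ), Function.Injective n →
      ((∫ ω, ∏ i, ξ (n i) ω ∂P : ℝ) : ℂ) =
        Matrix.det (Matrix.of fun i j => fhat f (n i - n j)))
    (s : Finset ℤ) (a : ℤ → ℝ) :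
    (∫ t, f t * (1 - f t) ∂AddCircle.haarAddCircle) * ∑ i ∈ s, (a i)^2 ≤
      ∫ ω, (∑ i ∈ s, a i * (ξ i ω - σ))^2 ∂P := by
  have hcov := aux_cov f σ hσ P ξ hξ_meas hξ01 hDPP
  have hsq : ∀ ω, (∑ i ∈ s, a i * (ξ i ω - σ))^2 =
      ∑ i ∈ s, ∑ j ∈ s, (a i * a j) * ((ξ i ω - σ) * (ξ j ω - σ)) := by
    intro ω
    rw [sq, Finset.sum_mul_sum]
    exact Finset.sum_congr rfl fun i _ => Finset.sum_congr rfl fun j _ => by ring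
  simp_rw [hsq]
  rw [integral_finsetSum _ (fun i _ => integrable_finsetSum _ fun j _ =>
    (hcov i j).1.const_mul _)]
  have h1 : ∀ i ∈ s, ∫ ω, ∑ j ∈ s, (a i * a j) * ((ξ i ω - σ) * (ξ j ω - σ)) ∂P =
      σ * (a i)^2 - ∑ j ∈ s, (a i * a j) * ‖fhat f (i - j)‖^2 := by
    intro i hi
    rw [integral_finsetSum _ (fun j _ => (hcov i j).1.const_mul _)]
    simp_rw [integral_const_mul, (hcov _ _).2, mul_sub, Finset.sum_sub_distrib]
    simp [hi]
    ring
  rw [Finset.sum_congr rfl h1, Finset.sum_sub_distrib, ← Finset.mul_sum]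
  have hif : Integrable f AddCircle.haarAddCircle :=
    aux_integrable _ hf_meas ⟨1, fun t => by rw [abs_of_nonneg (hf01 t).1]; exact (hf01 t).2⟩
  have hif2 : Integrable (fun t => (f t)^2) AddCircle.haarAddCircle :=
    aux_integrable _ (hf_meas.pow_const 2) ⟨1, fun t => by
      rw [abs_of_nonneg (sq_nonneg _)]; nlinarith [(hf01 t).1, (hf01 t).2]⟩
  have hc : ∫ t, f t * (1 - f t) ∂AddCircle.haarAddCircle =
      σ - ∫ t, (f t)^2 ∂AddCircle.haarAddCircle := by
    rw [hσ, ← integral_sub hif hif2]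
    congr 1; funext t; ring
  rw [hc, sub_mul]
  refine sub_le_sub_left ?_ _
  set B := ∫ t, (f t)^2 ∂AddCircle.haarAddCircle
  have hsym : ∀ i j, ‖fhat f (i - j)‖ = ‖fhat f (j - i)‖ := by
    intro i j
    rw [← neg_sub j i, aux_fhat_neg, RCLike.norm_conj]
  have hA : ∑ i ∈ s, ∑ j ∈ s, (a i)^2 * ‖fhat f (i - j)‖^2 ≤ B * ∑ i ∈ s, (a i)^2 := by
    rw [Finset.mul_sum]
    refine Finset.sum_le_sum fun i _ => ?_
    rw [← Finset.mul_sum, mul_comm]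
    exact mul_le_mul_of_nonneg_right (aux_bessel f hf_meas hf01 s i) (sq_nonneg _)
  have hB : ∑ i ∈ s, ∑ j ∈ s, (a j)^2 * ‖fhat f (i - j)‖^2 ≤ B * ∑ i ∈ s, (a i)^2 := by
    rw [Finset.sum_comm]
    simp_rw [fun i j => hsym i j] at hA ⊢
    convert hA using 5
  have hC : ∑ i ∈ s, ∑ j ∈ s, (a i * a j) * ‖fhat f (i - j)‖^2 ≤
      ∑ i ∈ s, ∑ j ∈ s, (1/2) * ((a i)^2 * ‖fhat f (i - j)‖^2 + (a j)^2 * ‖fhat f (i - j)‖^2) := by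
    refine Finset.sum_le_sum fun i _ => Finset.sum_le_sum fun j _ => ?_
    have := mul_le_mul_of_nonneg_right (two_mul_le_add_sq (a i) (a j))
      (sq_nonneg ‖fhat f (i - j)‖)
    linarith
  refine hC.trans ?_
  simp_rw [← Finset.mul_sum, Finset.sum_add_distrib]
  linarith

lemma aux_pow4 (x y : ℝ) : (x + y)^4 ≤ 1331 * x^4 + (3/2) * y^4 := by
  have h1 : (x + y)^2 ≤ 11 * x^2 + (11/10) * y^2 := by nlinarith [sq_nonneg (10 * x - y)]
  have h2 : ((x + y)^2)^2 ≤ (11 * x^2 + (11/10) * y^2)^2 := pow_le_pow_left₀ (sq_nonneg _) h1 2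
  nlinarith [sq_nonneg (100 * x^2 - y^2), sq_nonneg (x^2), sq_nonneg (y^2),
    sq_nonneg (10 * x^2 - y^2)]

lemma aux_split (V : ℕ → ℝ) (hV : Monotone V) (m n : ℕ) (hmn : m < n) :
    ∃ h, m ≤ h ∧ h < n ∧ V h - V m ≤ (V n - V m) / 2 ∧ V n - V (h+1) ≤ (V n - V m) / 2 := by
  classical
  let p : ℕ → Prop := fun h => m ≤ h ∧ V h - V m ≤ (V n - V m) / 2
  have hm : p m := ⟨le_rfl, by have := hV hmn.le; linarith⟩
  have hg := Nat.findGreatest_spec (P := p) (n := n - 1) (m := m) (by omega) hm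
  have hle := Nat.findGreatest_le (P := p) (n - 1)
  set h := Nat.findGreatest p (n - 1) with hh
  refine ⟨h, hg.1, by omega, hg.2, ?_⟩
  by_cases hc : h = n - 1
  · have : h + 1 = n := by omega
    rw [this]; have := hV hmn.le; linarith
  · have hn : ¬ p (h+1) := Nat.findGreatest_is_greatest (n := n - 1) (k := h + 1)
      (by omega) (by omega)
    have : ¬ (V (h+1) - V m ≤ (V n - V m) / 2) := fun hx => hn ⟨by have := hg.1; omega, hx⟩
    push Not at this
    linarith

/-- Maximal inequality by bisection. -/
lemma aux_maximal {Ω : Type*} [MeasurableSpace Ω] (P : Measure Ω)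
    (Y : ℕ → Ω → ℝ) (V : ℕ → ℝ) (hV : Monotone V) (C : ℝ) (hC : 0 ≤ C)
    (hint : ∀ m n, Integrable (fun ω => (Y n ω - Y m ω)^4) P)
    (hmom : ∀ m n, m ≤ n → ∫ ω, (Y n ω - Y m ω)^4 ∂P ≤ C * (V n - V m)^2) :
    ∀ d m n, m ≤ n → n - m ≤ d → ∃ G : Ω → ℝ, Integrable G P ∧ (∀ ω, 0 ≤ G ω) ∧
      (∀ k, m ≤ k → k ≤ n → ∀ ω, (Y k ω - Y m ω)^4 ≤ G ω) ∧
      ∫ ω, G ω ∂P ≤ 5324 * C * (V n - V m)^2 := by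
  intro d
  induction d with
  | zero =>
    intro m n hmn hd
    have : m = n := by omega
    subst this
    refine ⟨fun _ => 0, integrable_zero _ _ _, fun _ => le_rfl, fun k h1 h2 ω => ?_, by simp⟩
    have : k = m := by omega
    simp [this]
  | succ d ih =>
    intro m n hmn hd
    rcases hmn.eq_or_lt with rfl | hlt
    · refine ⟨fun _ => 0, integrable_zero _ _ _, fun _ => le_rfl, fun k h1 h2 ω => ?_, by simp⟩
      have : k = m := by omega
      simp [this]
    obtain ⟨h, hmh, hhn, hs1, hs2⟩ := aux_split V hV m n hlt
    obtain ⟨G1, i1, p1, b1, e1⟩ := ih m h hmh (by omega)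
    obtain ⟨G2, i2, p2, b2, e2⟩ := ih (h+1) n (by omega) (by omega)
    have iA := (hint m (h+1)).const_mul 1331
    have iB := (i1.add i2).const_mul (3/2)
    have pA : ∀ ω, 0 ≤ (Y (h+1) ω - Y m ω)^4 := fun ω => Even.pow_nonneg (by decide) _
    refine ⟨fun ω => 1331 * (Y (h+1) ω - Y m ω)^4 + (3/2) * (G1 ω + G2 ω), iA.add iB,
      fun ω => ?_, fun k hk1 hk2 ω => ?_, ?_⟩
    · have := p1 ω; have := p2 ω; have := pA ω; positivity
    · have q1 := p1 ω; have q2 := p2 ω; have q3 := pA ω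
      by_cases hkh : k ≤ h
      · have := b1 k hk1 hkh ω
        linarith
      · have := b2 k (by omega) hk2 ω
        have h4 := aux_pow4 (Y (h+1) ω - Y m ω) (Y k ω - Y (h+1) ω)
        rw [show Y (h+1) ω - Y m ω + (Y k ω - Y (h+1) ω) = Y k ω - Y m ω by ring] at h4
        linarith
    · have hI : ∫ ω, (1331 * (Y (h+1) ω - Y m ω)^4 + (3/2) * (G1 ω + G2 ω)) ∂P =
          1331 * ∫ ω, (Y (h+1) ω - Y m ω)^4 ∂P + (3/2) * (∫ ω, G1 ω ∂P + ∫ ω, G2 ω ∂P) := by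
        rw [← integral_add i1 i2, ← integral_const_mul, ← integral_const_mul]
        exact integral_add iA iB
      rw [hI]
      have hm1 := hmom m (h+1) (by omega)
      have hU : 0 ≤ V n - V m := by have := hV hmn; linarith
      have v1 : (V (h+1) - V m)^2 ≤ (V n - V m)^2 := by
        apply pow_le_pow_left₀
        · have := hV (show m ≤ h+1 by omega); linarith
        · have := hV (show h+1 ≤ n by omega); linarith
      have v2 : (V h - V m)^2 ≤ ((V n - V m)/2)^2 := by
        apply pow_le_pow_left₀ _ hs1
        have := hV hmh; linarith
      have v3 : (V n - V (h+1))^2 ≤ ((V n - V m)/2)^2 := by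
        apply pow_le_pow_left₀ _ hs2
        have := hV (show h+1 ≤ n by omega); linarith
      have w1 := mul_le_mul_of_nonneg_left v1 hC
      have w2 := mul_le_mul_of_nonneg_left v2 hC
      have w3 := mul_le_mul_of_nonneg_left v3 hC
      nlinarith

lemma aux_conv {Ω : Type*} [MeasurableSpace Ω] (P : Measure Ω) [IsProbabilityMeasure P]
    (Y : ℕ → Ω → ℝ) (V : ℕ → ℝ) (hV : Monotone V)
    (hVb : BddAbove (Set.range V)) (C : ℝ) (hC : 0 ≤ C)
    (hint : ∀ m n, Integrable (fun ω => (Y n ω - Y m ω)^4) P)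
    (hmom : ∀ m n, m ≤ n → ∫ ω, (Y n ω - Y m ω)^4 ∂P ≤ C * (V n - V m)^2) :
    ∀ᵐ ω ∂P, ∃ L : ℝ, Tendsto (fun n => Y n ω) atTop (nhds L) := by
  have hmax := aux_maximal P Y V hV C hC hint hmom
  set L := ⨆ n, V n with hL
  have hVL : Tendsto V atTop (nhds L) := tendsto_atTop_ciSup hV hVb
  have hle : ∀ n, V n ≤ L := fun n => le_ciSup hVb n
  -- bound on the bad events
  have hbad : ∀ ε : ℝ, 0 < ε → ∀ m, P {ω | ∃ k, m ≤ k ∧ ε ≤ (Y k ω - Y m ω)^4} ≤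
      ENNReal.ofReal (5324 * C * (L - V m)^2 / ε) := by
    intro ε hε m
    have hun : {ω | ∃ k, m ≤ k ∧ ε ≤ (Y k ω - Y m ω)^4} =
        ⋃ n, {ω | ∃ k, m ≤ k ∧ k ≤ n ∧ ε ≤ (Y k ω - Y m ω)^4} := by
      ext ω
      simp only [Set.mem_ofPred_eq, Set.mem_iUnion]
      constructor
      · rintro ⟨k, h1, h2⟩; exact ⟨k, k, h1, le_rfl, h2⟩
      · rintro ⟨n, k, h1, -, h2⟩; exact ⟨k, h1, h2⟩
    have hmono : Monotone (fun n => {ω | ∃ k, m ≤ k ∧ k ≤ n ∧ ε ≤ (Y k ω - Y m ω)^4}) := by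
      intro n n' hn ω
      rintro ⟨k, h1, h2, h3⟩
      exact ⟨k, h1, h2.trans hn, h3⟩
    rw [hun, hmono.measure_iUnion]
    refine iSup_le fun n => ?_
    by_cases hmn : m ≤ n
    · obtain ⟨G, iG, pG, bG, eG⟩ := hmax (n - m) m n hmn le_rfl
      have hsub : {ω | ∃ k, m ≤ k ∧ k ≤ n ∧ ε ≤ (Y k ω - Y m ω)^4} ⊆ {ω | ε ≤ G ω} := by
        rintro ω ⟨k, h1, h2, h3⟩
        exact h3.trans (bG k h1 h2 ω)
      refine (measure_mono hsub).trans ?_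
      have hmk := mul_meas_ge_le_integral_of_nonneg (Eventually.of_forall pG) iG ε
      rw [← ENNReal.ofReal_toReal (measure_ne_top P {ω | ε ≤ G ω})]
      apply ENNReal.ofReal_le_ofReal
      rw [le_div_iff₀ hε]
      have h1 : (V n - V m)^2 ≤ (L - V m)^2 := by
        apply pow_le_pow_left₀
        · have := hV hmn; linarith
        · have := hle n; linarith
      have h2 := mul_le_mul_of_nonneg_left h1 hC
      have h3 : (P {ω | ε ≤ G ω}).toReal = P.real {ω | ε ≤ G ω} := rfl
      rw [h3]
      linarith
    · have : {ω | ∃ k, m ≤ k ∧ k ≤ n ∧ ε ≤ (Y k ω - Y m ω)^4} = ∅ := by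
        ext ω
        simp only [Set.mem_ofPred_eq, Set.mem_empty_iff_false, iff_false]
        rintro ⟨k, h1, h2, -⟩; omega
      rw [this]; simp
  have hzero : ∀ ε : ℝ, 0 < ε → ∀ᵐ ω ∂P, ∃ m, ∀ k, m ≤ k → (Y k ω - Y m ω)^4 < ε := by
    intro ε hε
    rw [ae_iff]
    have hlim : Tendsto (fun m => ENNReal.ofReal (5324 * C * (L - V m)^2 / ε)) atTop (nhds 0) := by
      rw [← ENNReal.ofReal_zero]
      apply ENNReal.tendsto_ofReal
      have := ((((tendsto_const_nhds (x := L)).sub hVL).pow 2).const_mul (5324 * C)).div_const ε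
      simpa using this
    refine le_antisymm (ge_of_tendsto' hlim fun m => le_trans (measure_mono ?_) (hbad ε hε m))
      (zero_le)
    intro ω hω
    simp only [Set.mem_ofPred_eq] at hω ⊢
    push Not at hω
    exact hω m
  have hall : ∀ᵐ ω ∂P, ∀ j : ℕ, ∃ m, ∀ k, m ≤ k → (Y k ω - Y m ω)^4 < (1/((j:ℝ)+1))^4 :=
    ae_all_iff.mpr fun j => hzero _ (by positivity)
  filter_upwards [hall] with ω hω
  apply cauchySeq_tendsto_of_complete
  rw [Metric.cauchySeq_iff']
  intro ε hε
  obtain ⟨j, hj⟩ := exists_nat_one_div_lt hε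
  obtain ⟨m, hm⟩ := hω j
  refine ⟨m, fun k hk => lt_trans ?_ hj⟩
  rw [Real.dist_eq]
  have := hm k hk
  rw [← Even.pow_abs (show Even 4 by decide)] at this
  exact lt_of_pow_lt_pow_left₀ 4 (by positivity) this

lemma aux_converse {Ω : Type*} [MeasurableSpace Ω] (P : Measure Ω) [IsProbabilityMeasure P]
    (Y : ℕ → Ω → ℝ) (V : ℕ → ℝ) (hV : Monotone V) (c C : ℝ) (hc : 0 < c) (hC : 0 < C)
    (hmeas : ∀ n, Measurable (Y n))
    (hint2 : ∀ n, Integrable (fun ω => (Y n ω)^2) P)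
    (hint4 : ∀ n, Integrable (fun ω => (Y n ω)^4) P)
    (hsec : ∀ n, c * V n ≤ ∫ ω, (Y n ω)^2 ∂P)
    (hmom : ∀ n, ∫ ω, (Y n ω)^4 ∂P ≤ C * (V n)^2)
    (hconv : ∀ᵐ ω ∂P, ∃ L : ℝ, Tendsto (fun n => Y n ω) atTop (nhds L)) :
    BddAbove (Set.range V) := by
  by_contra hb
  have hVt : Tendsto V atTop atTop := by
    refine tendsto_atTop_atTop_of_monotone hV fun B => ?_
    by_contra! hB
    exact hb ⟨B, by rintro _ ⟨n, rfl⟩; exact (hB n).le⟩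
  set l := 2 * C / c with hl
  have hl0 : 0 < l := by positivity
  have hlim : Tendsto (fun n => ∫ ω, min ((Y n ω)^2 / V n) l ∂P) atTop
      (nhds (∫ _ω, (0:ℝ) ∂P)) := by
    have hVpos : ∀ᶠ n in atTop, 0 < V n := hVt.eventually_gt_atTop 0
    refine tendsto_integral_filter_of_dominated_convergence (fun _ => l) ?_ ?_
      (integrable_const _) ?_
    · exact Eventually.of_forall fun n =>
        ((((hmeas n).pow_const 2).div_const _).min measurable_const).aestronglyMeasurable
    · filter_upwards [hVpos] with n hn
      refine Eventually.of_forall fun ω => ?_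
      rw [Real.norm_of_nonneg (le_min (by positivity) hl0.le)]
      exact min_le_right _ _
    · filter_upwards [hconv] with ω ⟨L, hL⟩
      have h1 : Tendsto (fun n => (Y n ω)^2 / V n) atTop (nhds 0) := (hL.pow 2).div_atTop hVt
      have h2 := h1.min (tendsto_const_nhds (x := l))
      rwa [min_eq_left hl0.le] at h2
  rw [integral_zero] at hlim
  have hev := (hlim.eventually (gt_mem_nhds (show (0:ℝ) < c/2 by positivity))).and
    (hVt.eventually_gt_atTop 0)
  obtain ⟨n, hn, hVn⟩ := hev.exists
  have hpt : ∀ ω, (Y n ω)^2 / V n ≤ min ((Y n ω)^2 / V n) l + (Y n ω)^4 / (l * (V n)^2) := by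
    intro ω
    have h4 : (Y n ω)^4 / (l * (V n)^2) = ((Y n ω)^2 / V n)^2 / l := by
      field_simp
    rw [h4]
    set z := (Y n ω)^2 / V n
    have hz : 0 ≤ z := by positivity
    rcases le_total z l with h | h
    · rw [min_eq_left h]; have : 0 ≤ z^2/l := by positivity
      linarith
    · rw [min_eq_right h]
      have : z ≤ z^2 / l := by rw [le_div_iff₀ hl0]; nlinarith
      linarith
  have im : Integrable (fun ω => min ((Y n ω)^2 / V n) l) P := by
    refine aux_integrable P (((hmeas n).pow_const 2).div_const _ |>.min measurable_const)
      ⟨l, fun ω => ?_⟩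
    rw [abs_of_nonneg (le_min (by positivity) hl0.le)]
    exact min_le_right _ _
  have hI := integral_mono ((hint2 n).div_const (V n))
    (im.add ((hint4 n).div_const (l * (V n)^2))) hpt
  have hadd : ∫ ω, ((fun ω => min ((Y n ω)^2 / V n) l) +
      fun ω => (Y n ω)^4 / (l * (V n)^2)) ω ∂P =
      ∫ ω, min ((Y n ω)^2 / V n) l ∂P + (∫ ω, (Y n ω)^4 ∂P) / (l * (V n)^2) := by
    simp only [Pi.add_apply]
    rw [integral_add im ((hint4 n).div_const (l * (V n)^2)), integral_div]
  rw [hadd, integral_div] at hI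
  have h1 : c ≤ (∫ ω, (Y n ω)^2 ∂P) / V n := by
    rw [le_div_iff₀ hVn]; exact hsec n
  have h2 : (∫ ω, (Y n ω)^4 ∂P) / (l * (V n)^2) ≤ c / 2 := by
    rw [div_le_iff₀ (by positivity)]
    refine (hmom n).trans (le_of_eq ?_)
    rw [hl]; field_simp
  linarith

lemma aux_Icc_mono : Monotone (fun N : ℕ => Finset.Icc (-(N:ℤ)) (N:ℤ)) := by
  intro m n h
  apply Finset.Icc_subset_Icc <;> simp [h]

lemma aux_summable_iff (a : ℤ → ℝ) :
    Summable (fun n => (a n)^2) ↔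
      BddAbove (Set.range fun N : ℕ => ∑ n ∈ Finset.Icc (-(N:ℤ)) (N:ℤ), (a n)^2) := by
  constructor
  · intro h
    refine ⟨∑' n, (a n)^2, ?_⟩
    rintro _ ⟨N, rfl⟩
    exact h.sum_le_tsum _ (fun _ _ => sq_nonneg _)
  · rintro ⟨B, hB⟩
    refine summable_of_sum_le (c := B) (fun _ => sq_nonneg _) fun u => ?_
    have hsub : u ⊆ Finset.Icc (-((∑ i ∈ u, i.natAbs : ℕ):ℤ)) ((∑ i ∈ u, i.natAbs : ℕ):ℤ) := by
      intro i hi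
      have : i.natAbs ≤ ∑ i ∈ u, i.natAbs :=
        Finset.single_le_sum (f := fun i : ℤ => i.natAbs) (fun _ _ => Nat.zero_le _) hi
      rw [Finset.mem_Icc]
      omega
    exact (Finset.sum_le_sum_of_subset_of_nonneg hsub fun _ _ _ => sq_nonneg _).trans
      (hB ⟨_, rfl⟩)

lemma aux_real (f : AddCircle (1:ℝ) → ℝ) (hf_meas : Measurable f)
    (hf01 : ∀ t, f t ∈ Set.Icc (0:ℝ) 1)
    (σ : ℝ) (hσ : σ = ∫ t, f t ∂AddCircle.haarAddCircle)
    (hσ0 : 0 < σ) (hσ1 : σ < 1)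
    {Ω : Type*} [MeasurableSpace Ω] (P : Measure Ω) [IsProbabilityMeasure P]
    (ξ : ℤ → Ω → ℝ) (hξ_meas : ∀ n, Measurable (ξ n))
    (hξ01 : ∀ n ω, ξ n ω = 0 ∨ ξ n ω = 1)
    (hDPP : ∀ (k : ℕ) (n : Fin k → ℤ), Function.Injective n →
      ((∫ ω, ∏ i, ξ (n i) ω ∂P : ℝ) : ℂ) =
        Matrix.det (Matrix.of fun i j => fhat f (n i - n j)))
    (hind : 0 < ∫ t, f t * (1 - f t) ∂AddCircle.haarAddCircle) (a : ℤ → ℝ) :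
    (∀ᵐ ω ∂P, ∃ L : ℝ, Tendsto (fun N : ℕ =>
          ∑ n ∈ Finset.Icc (-(N:ℤ)) (N:ℤ), a n * (ξ n ω - σ)) atTop (nhds L))
        ↔ Summable (fun n : ℤ => (a n)^2) := by
  rw [aux_summable_iff]
  have hV : Monotone (fun N : ℕ => ∑ n ∈ Finset.Icc (-(N:ℤ)) (N:ℤ), (a n)^2) := fun m n h =>
    Finset.sum_le_sum_of_subset_of_nonneg (aux_Icc_mono h) fun _ _ _ => sq_nonneg _
  constructor
  · intro h
    exact aux_converse P (fun N ω => ∑ n ∈ Finset.Icc (-(N:ℤ)) (N:ℤ), a n * (ξ n ω - σ)) _ hV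
      _ 2304 hind (by norm_num) (fun n => aux_S_meas ξ hξ_meas σ _ a)
      (fun n => aux_S_int_pow P ξ hξ_meas hξ01 σ _ a 2)
      (fun n => aux_S_int_pow P ξ hξ_meas hξ01 σ _ a 4)
      (fun n => aux_second f hf_meas hf01 σ hσ P ξ hξ_meas hξ01 hDPP _ a)
      (fun n => aux_fourth f hf_meas hf01 σ hσ hσ0 hσ1 P ξ hξ_meas hξ01 hDPP _ a) h
  · intro h
    have hd : ∀ (g : ℤ → ℝ) (m n : ℕ), m ≤ n →
        ∑ i ∈ Finset.Icc (-(n:ℤ)) (n:ℤ), g i - ∑ i ∈ Finset.Icc (-(m:ℤ)) (m:ℤ), g i =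
        ∑ i ∈ Finset.Icc (-(n:ℤ)) (n:ℤ) \ Finset.Icc (-(m:ℤ)) (m:ℤ), g i := by
      intro g m n hmn
      rw [← Finset.sum_sdiff (aux_Icc_mono hmn)]
      simp
    have hint0 : ∀ m n : ℕ, m ≤ n → Integrable (fun ω =>
        (∑ i ∈ Finset.Icc (-(n:ℤ)) (n:ℤ), a i * (ξ i ω - σ) -
          ∑ i ∈ Finset.Icc (-(m:ℤ)) (m:ℤ), a i * (ξ i ω - σ))^4) P := by
      intro m n hmn
      simp_rw [fun ω => hd (fun i => a i * (ξ i ω - σ)) m n hmn]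
      exact aux_S_int_pow P ξ hξ_meas hξ01 σ _ a 4
    refine aux_conv P (fun N ω => ∑ n ∈ Finset.Icc (-(N:ℤ)) (N:ℤ), a n * (ξ n ω - σ)) _ hV h
      2304 (by norm_num) (fun m n => ?_) (fun m n hmn => ?_)
    · rcases le_total m n with hmn | hmn
      · exact hint0 m n hmn
      · convert hint0 n m hmn using 2 with ω
        rw [← neg_sub, Even.neg_pow (by decide)]
    · rw [hd _ m n hmn]
      simp_rw [fun ω => hd (fun i => a i * (ξ i ω - σ)) m n hmn]
      exact aux_fourth f hf_meas hf01 σ hσ hσ0 hσ1 P ξ hξ_meas hξ01 hDPP _ a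

/-- Almost sure convergence criterion: if f is not a.e. an indicator, the symmetric
partial sums ∑_{|n|≤N} a_n(ξ_n−σ) converge a.s. iff ∑ |a_n|² < ∞. -/
theorem stmt_16
    (f : AddCircle (1:ℝ) → ℝ) (hf_meas : Measurable f)
    (hf01 : ∀ t, f t ∈ Set.Icc (0:ℝ) 1)
    (σ : ℝ) (hσ : σ = ∫ t, f t ∂AddCircle.haarAddCircle)
    (hσ0 : 0 < σ) (hσ1 : σ < 1)
    {Ω : Type*} [MeasurableSpace Ω] (P : Measure Ω) [IsProbabilityMeasure P]
    (ξ : ℤ → Ω → ℝ) (hξ_meas : ∀ n, Measurable (ξ n))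
    (hξ01 : ∀ n ω, ξ n ω = 0 ∨ ξ n ω = 1)
    (hDPP : ∀ (k : ℕ) (n : Fin k → ℤ), Function.Injective n →
      ((∫ ω, ∏ i, ξ (n i) ω ∂P : ℝ) : ℂ) =
        Matrix.det (Matrix.of fun i j => fhat f (n i - n j)))
    (hind : 0 < ∫ t, f t * (1 - f t) ∂AddCircle.haarAddCircle) :
    ∀ a : ℤ → ℂ,
      ((∀ᵐ ω ∂P, ∃ L : ℂ, Tendsto (fun N : ℕ =>
          ∑ n ∈ Finset.Icc (-(N:ℤ)) (N:ℤ), a n * ((ξ n ω : ℂ) - (σ:ℂ)))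
          atTop (nhds L))
        ↔ Summable (fun n : ℤ => ‖a n‖^2)) := by
  intro a
  have hre := aux_real f hf_meas hf01 σ hσ hσ0 hσ1 P ξ hξ_meas hξ01 hDPP hind (fun n => (a n).re)
  have him := aux_real f hf_meas hf01 σ hσ hσ0 hσ1 P ξ hξ_meas hξ01 hDPP hind (fun n => (a n).im)
  have hnorm : ∀ n, ‖a n‖^2 = (a n).re^2 + (a n).im^2 := by
    intro n; rw [← Complex.normSq_eq_norm_sq, Complex.normSq_apply]; ring
  have hsre : ∀ (N : ℕ) ω, (∑ n ∈ Finset.Icc (-(N:ℤ)) (N:ℤ), a n * ((ξ n ω : ℂ) - (σ:ℂ))).re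
      = ∑ n ∈ Finset.Icc (-(N:ℤ)) (N:ℤ), (a n).re * (ξ n ω - σ) := by
    intro N ω; rw [Complex.re_sum]
    exact Finset.sum_congr rfl fun n _ => by simp
  have hsim : ∀ (N : ℕ) ω, (∑ n ∈ Finset.Icc (-(N:ℤ)) (N:ℤ), a n * ((ξ n ω : ℂ) - (σ:ℂ))).im
      = ∑ n ∈ Finset.Icc (-(N:ℤ)) (N:ℤ), (a n).im * (ξ n ω - σ) := by
    intro N ω; rw [Complex.im_sum]
    exact Finset.sum_congr rfl fun n _ => by simp
  constructor
  · intro h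
    have h1 := hre.mp (by
      filter_upwards [h] with ω ⟨L, hL⟩
      refine ⟨L.re, ?_⟩
      have := (Complex.continuous_re.tendsto L).comp hL
      simpa only [Function.comp_def, hsre] using this)
    have h2 := him.mp (by
      filter_upwards [h] with ω ⟨L, hL⟩
      refine ⟨L.im, ?_⟩
      have := (Complex.continuous_im.tendsto L).comp hL
      simpa only [Function.comp_def, hsim] using this)
    simp_rw [hnorm]
    exact h1.add h2
  · intro h
    have h1 : Summable (fun n => (a n).re^2) := h.of_nonneg_of_le (fun _ => sq_nonneg _)
      fun n => by rw [hnorm]; linarith [sq_nonneg (a n).im]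
    have h2 : Summable (fun n => (a n).im^2) := h.of_nonneg_of_le (fun _ => sq_nonneg _)
      fun n => by rw [hnorm]; linarith [sq_nonneg (a n).re]
    filter_upwards [hre.mpr h1, him.mpr h2] with ω ⟨L, hL⟩ ⟨L', hL'⟩
    refine ⟨(L : ℂ) + (L' : ℂ) * Complex.I, ?_⟩
    have h3 := ((Complex.continuous_ofReal.tendsto L).comp hL).add
      (((Complex.continuous_ofReal.tendsto L').comp hL').mul_const Complex.I)
    refine h3.congr fun N => ?_
    simp only [Function.comp_def]
    rw [← hsre, ← hsim, Complex.re_add_im]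
end

section
/- Almost surely, 𝔛 + 𝔛 = ℤ: for ℙ-almost every ω, for every m ∈ ℤ there exists n ∈ ℤ such that ξ_n(ω) = 1 and ξ_{m−n}(ω) = 1. -/
open MeasureTheory Complex Filter Finset
open scoped ENNReal

open Topology in
lemma fhat_tendsto (f : AddCircle (1:ℝ) → ℝ) (hf_meas : Measurable f)
    (hf01 : ∀ t, f t ∈ Set.Icc (0:ℝ) 1) : Tendsto (fhat f) cofinite (𝓝 0) := by
  have hL : MemLp (fun t => (f t : ℂ)) 2 (AddCircle.haarAddCircle (T := (1:ℝ))) := by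
    refine MemLp.of_bound (Complex.measurable_ofReal.comp hf_meas).aestronglyMeasurable 1 ?_
    refine Eventually.of_forall fun t => ?_
    have := hf01 t
    simp only [Complex.norm_real, Real.norm_eq_abs]
    rw [abs_of_nonneg this.1]; exact this.2
  have h1 := (hasSum_sq_fourierCoeff (hL.toLp _)).summable.tendsto_cofinite_zero
  have h2 : ∀ k, fourierCoeff (hL.toLp _) k = fhat f k := by
    intro k
    unfold fhat fourierCoeff
    apply integral_congr_ae
    filter_upwards [hL.coeFn_toLp] with t ht
    rw [ht]
  simp only [h2] at h1
  rw [tendsto_zero_iff_norm_tendsto_zero]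
  have := h1.sqrt
  simpa using this

open Topology in
lemma moment_tendsto
    (f : AddCircle (1:ℝ) → ℝ) (hf_meas : Measurable f)
    (hf01 : ∀ t, f t ∈ Set.Icc (0:ℝ) 1)
    (σ : ℝ) (hσ : σ = ∫ t, f t ∂AddCircle.haarAddCircle)
    {Ω : Type*} [MeasurableSpace Ω] (P : Measure Ω)
    (ξ : ℤ → Ω → ℝ)
    (hDPP : ∀ (k : ℕ) (n : Fin k → ℤ), Function.Injective n →
      ((∫ ω, ∏ i, ξ (n i) ω ∂P : ℝ) : ℂ) =
        Matrix.det (Matrix.of fun i j => fhat f (n i - n j)))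
    (k : ℕ) (s b : Fin k → ℤ) (hs : Function.Injective s) :
    Tendsto (fun M : ℕ => ∫ ω, ∏ i, ξ (s i * M + b i) ω ∂P) atTop (𝓝 (σ ^ k)) := by
  have hdiff : ∀ i j, i ≠ j →
      Tendsto (fun M : ℕ => (s i * M + b i) - (s j * M + b j)) atTop cofinite := by
    intro i j hij
    rw [← Nat.cofinite_eq_atTop]
    apply Function.Injective.tendsto_cofinite
    intro x y hxy
    have hne : s i - s j ≠ 0 := sub_ne_zero.2 (hs.ne hij)
    have : (s i - s j) * (x : ℤ) = (s i - s j) * y := by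
      simp only at hxy; linear_combination hxy
    exact_mod_cast mul_left_cancel₀ hne this
  have h0 : fhat f 0 = (σ : ℂ) := by
    unfold fhat fourierCoeff
    simp only [neg_zero, fourier_zero, one_smul]
    rw [hσ]; exact integral_ofReal
  have hinj : ∀ᶠ M : ℕ in atTop, Function.Injective (fun i => s i * M + b i) := by
    have : ∀ᶠ M : ℕ in atTop, ∀ i j, i ≠ j → (s i * M + b i) - (s j * M + b j) ≠ 0 := by
      rw [eventually_all]; intro i
      rw [eventually_all]; intro j
      by_cases hij : i = j
      · simp [hij]
      · filter_upwards [(hdiff i j hij).eventually (eventually_cofinite_ne 0)] with M hM _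
        exact hM
    filter_upwards [this] with M hM i j hij
    by_contra hne
    exact hM i j hne (sub_eq_zero.2 hij)
  have hmat : Tendsto (fun M : ℕ => (Matrix.of fun i j : Fin k =>
      fhat f ((s i * M + b i) - (s j * M + b j)))) atTop
      (𝓝 (Matrix.diagonal fun _ => (σ : ℂ))) := by
    refine tendsto_pi_nhds.2 fun i => tendsto_pi_nhds.2 fun j => ?_
    by_cases hij : i = j
    · subst hij
      simp [h0]
    · simp only [Matrix.of_apply, Matrix.diagonal_apply_ne _ hij]
      exact (fhat_tendsto f hf_meas hf01).comp (hdiff i j hij)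
  have hdet := ((continuous_id.matrix_det (n := Fin k) (R := ℂ)).tendsto _).comp hmat
  simp only [id, Matrix.det_diagonal, Finset.prod_const, Finset.card_univ, Fintype.card_fin]
    at hdet
  have h3 : Tendsto (fun M : ℕ => ((∫ ω, ∏ i, ξ (s i * M + b i) ω ∂P : ℝ) : ℂ)) atTop
      (𝓝 ((σ : ℂ) ^ k)) := by
    refine hdet.congr' ?_
    filter_upwards [hinj] with M hM
    exact (hDPP k _ hM).symm
  have h4 := (Complex.continuous_re.tendsto _).comp h3
  rw [← Complex.ofReal_pow, Complex.ofReal_re] at h4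
  simpa [Function.comp_def] using h4

open Topology in
lemma single_m
    (f : AddCircle (1:ℝ) → ℝ) (hf_meas : Measurable f)
    (hf01 : ∀ t, f t ∈ Set.Icc (0:ℝ) 1)
    (σ : ℝ) (hσ : σ = ∫ t, f t ∂AddCircle.haarAddCircle)
    (hσ0 : 0 < σ)
    {Ω : Type*} [MeasurableSpace Ω] (P : Measure Ω) [IsProbabilityMeasure P]
    (ξ : ℤ → Ω → ℝ) (hξ_meas : ∀ n, Measurable (ξ n))
    (hξ01 : ∀ n ω, ξ n ω = 0 ∨ ξ n ω = 1)
    (hDPP : ∀ (k : ℕ) (n : Fin k → ℤ), Function.Injective n →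
      ((∫ ω, ∏ i, ξ (n i) ω ∂P : ℝ) : ℂ) =
        Matrix.det (Matrix.of fun i j => fhat f (n i - n j))) (m : ℤ) :
    ∀ᵐ ω ∂P, ∃ n : ℤ, ξ n ω = 1 ∧ ξ (m - n) ω = 1 := by
  have hmom := moment_tendsto f hf_meas hf01 σ hσ P ξ hDPP
  set X : ℕ → ℕ → Ω → ℝ := fun M i ω =>
    ξ (((i:ℤ)+1) * M) ω * ξ (m - ((i:ℤ)+1) * M) ω with hX
  have hX01 : ∀ M i ω, X M i ω = 0 ∨ X M i ω = 1 := by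
    intro M i ω
    rcases hξ01 (((i:ℤ)+1) * M) ω with h | h <;>
    rcases hξ01 (m - ((i:ℤ)+1) * M) ω with h' | h' <;> simp [hX, h, h']
  have hXm : ∀ M i, Measurable (X M i) := fun M i => (hξ_meas _).mul (hξ_meas _)
  have hXi : ∀ M i, Integrable (X M i) P := by
    intro M i
    refine Integrable.of_bound (hXm M i).aestronglyMeasurable 1 (Eventually.of_forall fun ω => ?_)
    rcases hX01 M i ω with h | h <;> simp [h]
  have hXXi : ∀ M i j, Integrable (fun ω => X M i ω * X M j ω) P := by
    intro M i j
    refine Integrable.of_bound ((hXm M i).mul (hXm M j)).aestronglyMeasurable 1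
      (Eventually.of_forall fun ω => ?_)
    rcases hX01 M i ω with h | h <;> rcases hX01 M j ω with h' | h' <;> simp [h, h']
  have hE1 : ∀ i, Tendsto (fun M => ∫ ω, X M i ω ∂P) atTop (𝓝 (σ^2)) := by
    intro i
    have := hmom 2 ![(i:ℤ)+1, -((i:ℤ)+1)] ![0, m] (by
      intro a b hab
      fin_cases a <;> fin_cases b <;> simp at hab ⊢ <;> omega)
    refine this.congr fun M => ?_
    congr 1; ext ω
    simp only [Fin.prod_univ_two, hX, Matrix.cons_val_zero, Matrix.cons_val_one]
    congr 2 <;> ring_nf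
  have hE2 : ∀ i j, i ≠ j →
      Tendsto (fun M => ∫ ω, X M i ω * X M j ω ∂P) atTop (𝓝 (σ^4)) := by
    intro i j hij
    have := hmom 4 ![(i:ℤ)+1, -((i:ℤ)+1), (j:ℤ)+1, -((j:ℤ)+1)] ![0, m, 0, m] (by
      intro a b hab
      fin_cases a <;> fin_cases b <;> simp at hab ⊢ <;> omega)
    refine this.congr fun M => ?_
    congr 1; ext ω
    simp only [Fin.prod_univ_four, hX]
    simp only [Matrix.cons_val]
    rw [← mul_assoc]
    ring_nf
  -- centred products
  set C : ℕ → ℕ → ℕ → ℝ := fun M i j => ∫ ω, (X M i ω - σ^2) * (X M j ω - σ^2) ∂P with hC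
  have hCe : ∀ M i j, C M i j = (∫ ω, X M i ω * X M j ω ∂P) - σ^2 * (∫ ω, X M i ω ∂P)
      - σ^2 * (∫ ω, X M j ω ∂P) + σ^4 := by
    intro M i j
    have : ∀ ω, (X M i ω - σ^2) * (X M j ω - σ^2) =
      X M i ω * X M j ω - σ^2 * X M i ω - σ^2 * X M j ω + σ^4 := fun ω => by ring
    simp only [hC, this]
    have i1 := (hXi M i).const_mul (σ^2)
    have i2 := (hXi M j).const_mul (σ^2)
    have i3 : Integrable (fun ω => X M i ω * X M j ω - σ^2 * X M i ω) P := (hXXi M i j).sub i1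
    have i4 : Integrable (fun ω => X M i ω * X M j ω - σ^2 * X M i ω - σ^2 * X M j ω) P :=
      i3.sub i2
    rw [integral_add i4 (integrable_const _), integral_sub i3 i2, integral_sub (hXXi M i j) i1,
      integral_const_mul, integral_const_mul]
    simp
  have hClim : ∀ i j, Tendsto (fun M => C M i j) atTop
      (𝓝 (if i = j then σ^2 - σ^4 else 0)) := by
    intro i j
    simp only [hCe]
    split_ifs with hij
    · subst hij
      have hsq : ∀ M ω, X M i ω * X M i ω = X M i ω := by
        intro M ω
        rcases hX01 M i ω with h | h <;> simp [h]
      simp only [hsq]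
      have := (((hE1 i).sub ((hE1 i).const_mul (σ^2))).sub ((hE1 i).const_mul (σ^2))).add_const (σ^4)
      convert this using 2
      ring
    · have := (((hE2 i j hij).sub ((hE1 i).const_mul (σ^2))).sub
        ((hE1 j).const_mul (σ^2))).add_const (σ^4)
      convert this using 2
      ring
  set B : Set Ω := {ω | ¬ ∃ n : ℤ, ξ n ω = 1 ∧ ξ (m - n) ω = 1} with hB
  have hBm : MeasurableSet B := by
    have : B = (⋃ n : ℤ, (ξ n ⁻¹' {1} ∩ ξ (m - n) ⁻¹' {1}))ᶜ := by
      ext ω; simp [hB]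
    rw [this]
    exact (MeasurableSet.iUnion fun n => ((hξ_meas n) (measurableSet_singleton 1)).inter
      ((hξ_meas (m-n)) (measurableSet_singleton 1))).compl
  have hXB : ∀ M i, ∀ ω ∈ B, X M i ω = 0 := by
    intro M i ω hω
    rcases hX01 M i ω with h | h
    · exact h
    · exfalso; apply hω
      refine ⟨((i:ℤ)+1) * M, ?_⟩
      rcases hξ01 (((i:ℤ)+1) * M) ω with h1 | h1 <;>
      rcases hξ01 (m - ((i:ℤ)+1) * M) ω with h2 | h2 <;> simp [hX, h1, h2] at h ⊢
  have hkey : ∀ N M : ℕ, P.real B * (N * σ^2)^2 ≤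
      ∑ i ∈ range N, ∑ j ∈ range N, C M i j := by
    intro N M
    have hint : ∀ i j, Integrable (fun ω => (X M i ω - σ^2) * (X M j ω - σ^2)) P := by
      intro i j
      have : ∀ ω, (X M i ω - σ^2) * (X M j ω - σ^2) =
        X M i ω * X M j ω - σ^2 * X M i ω - σ^2 * X M j ω + σ^4 := fun ω => by ring
      simp only [this]
      exact (((hXXi M i j).sub ((hXi M i).const_mul _)).sub ((hXi M j).const_mul _)).add
        (integrable_const _)
    have e : ∑ i ∈ range N, ∑ j ∈ range N, C M i j =
        ∫ ω, (∑ i ∈ range N, (X M i ω - σ^2))^2 ∂P := by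
      simp only [sq (∑ i ∈ range N, _), Finset.sum_mul_sum]
      rw [integral_finsetSum _ fun i _ => integrable_finsetSum _ fun j _ => hint i j]
      refine Finset.sum_congr rfl fun i _ => ?_
      rw [integral_finsetSum _ fun j _ => hint i j]
    rw [e]
    have e2 : P.real B * (N * σ^2)^2 = ∫ ω, B.indicator (fun _ => (N * σ^2)^2) ω ∂P := by
      rw [integral_indicator_const _ hBm, smul_eq_mul]
    rw [e2]
    refine integral_mono ((integrable_const _).indicator hBm) ?_ ?_
    · simp only [sq (∑ i ∈ range N, _), Finset.sum_mul_sum]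
      exact integrable_finsetSum _ fun i _ => integrable_finsetSum _ fun j _ => hint i j
    · intro ω
      by_cases hω : ω ∈ B
      · simp [hω, hXB M _ ω hω]
      · simp only [Set.indicator_of_notMem hω]
        positivity
  have hkey2 : ∀ N : ℕ, P.real B * (N * σ^2)^2 ≤ N * (σ^2 - σ^4) := by
    intro N
    have hl : Tendsto (fun M => ∑ i ∈ range N, ∑ j ∈ range N, C M i j) atTop
        (𝓝 (∑ i ∈ range N, ∑ j ∈ range N, (if i = j then σ^2 - σ^4 else 0))) :=
      tendsto_finsetSum _ fun i _ => tendsto_finsetSum _ fun j _ => hClim i j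
    have := ge_of_tendsto' hl (hkey N)
    refine this.trans_eq ?_
    rw [Finset.sum_congr rfl (g := fun _ => σ^2 - σ^4)]
    · simp; ring
    · intro i hi
      rw [Finset.sum_ite_eq, if_pos hi]
  have hzero : P.real B = 0 := by
    by_contra hne
    have hpos : 0 < P.real B := lt_of_le_of_ne measureReal_nonneg (Ne.symm hne)
    obtain ⟨N, hN⟩ := exists_nat_gt ((σ^2 - σ^4) / (P.real B * σ^4))
    have hN1 : (σ^2 - σ^4) / (P.real B * σ^4) < ((N+1 : ℕ) : ℝ) := by push_cast; linarith
    rw [div_lt_iff₀ (by positivity)] at hN1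
    have h := hkey2 (N+1)
    have hp : (0:ℝ) < ((N+1 : ℕ) : ℝ) := by positivity
    have := mul_lt_mul_of_pos_left hN1 hp
    nlinarith
  rw [ae_iff]
  exact (measureReal_eq_zero_iff).1 hzero

/-- Almost surely 𝔛 + 𝔛 = ℤ: for a.e. ω, every m ∈ ℤ is a sum of two elements of 𝔛. -/
theorem stmt_17
    (f : AddCircle (1:ℝ) → ℝ) (hf_meas : Measurable f)
    (hf01 : ∀ t, f t ∈ Set.Icc (0:ℝ) 1)
    (σ : ℝ) (hσ : σ = ∫ t, f t ∂AddCircle.haarAddCircle)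
    (hσ0 : 0 < σ) (hσ1 : σ < 1)
    {Ω : Type*} [MeasurableSpace Ω] (P : Measure Ω) [IsProbabilityMeasure P]
    (ξ : ℤ → Ω → ℝ) (hξ_meas : ∀ n, Measurable (ξ n))
    (hξ01 : ∀ n ω, ξ n ω = 0 ∨ ξ n ω = 1)
    (hDPP : ∀ (k : ℕ) (n : Fin k → ℤ), Function.Injective n →
      ((∫ ω, ∏ i, ξ (n i) ω ∂P : ℝ) : ℂ) =
        Matrix.det (Matrix.of fun i j => fhat f (n i - n j))) :
    ∀ᵐ ω ∂P, ∀ m : ℤ, ∃ n : ℤ, ξ n ω = 1 ∧ ξ (m - n) ω = 1 := by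
  rw [ae_all_iff]
  exact fun m => single_m f hf_meas hf01 σ hσ hσ0 P ξ hξ_meas hξ01 hDPP m
end
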